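/- If G is a disconnected graph on n vertices all of whose components have order at least 3, then b_g(G) ≤ (n+1)/2 and b_g'(G) ≤ n/2 + 1. -/

import Mathlib

namespace BurningGame

/-- One spreading phase: all neighbors of burned vertices become burned. -/
noncomputable def spread {V : Type*} [Fintype V] [DecidableEq V] (G : SimpleGraph V) (B : Finset V) : Finset V :=
  ((↑B : Set V) ∪ {v | ∃ u ∈ B, G.Adj u v}).toFinite.toFinset

/-- `EndBy G turn i B k`: starting from burned set `B` at round index `i`
(the player selecting in round `i` is Burner iff `turn i = true`; Burner's selections are
quantified existentially, Staller's universally), Burner can force the game to end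
within `k` further rounds. -/
def EndBy {V : Type*} [Fintype V] [DecidableEq V] (G : SimpleGraph V) (turn : ℕ → Bool) :
    ℕ → Finset V → ℕ → Prop
  | _, B, 0 => B = Finset.univ
  | i, B, k + 1 => B = Finset.univ ∨
      spread G B = Finset.univ ∨
      (if turn i then ∃ v ∉ spread G B, EndBy G turn (i + 1) (insert v (spread G B)) k
       else ∀ v ∉ spread G B, EndBy G turn (i + 1) (insert v (spread G B)) k)

/-- Game burning number relative to a preburned set `S` (Burner starts). -/
noncomputable def bgRel {V : Type*} [Fintype V] [DecidableEq V] (G : SimpleGraph V) (S : Finset V) : ℕ :=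
  sInf {k | EndBy G (fun i => i % 2 == 0) 0 S k}

/-- The game burning number (Burner starts). -/
noncomputable def bg {V : Type*} [Fintype V] [DecidableEq V] (G : SimpleGraph V) : ℕ := bgRel G ∅

/-- The Staller-start game burning number. -/
noncomputable def bg' {V : Type*} [Fintype V] [DecidableEq V] (G : SimpleGraph V) : ℕ :=
  sInf {k | EndBy G (fun i => i % 2 == 1) 0 ∅ k}

/-- The burning number: only Burner plays. -/
noncomputable def burn {V : Type*} [Fintype V] [DecidableEq V] (G : SimpleGraph V) : ℕ :=
  sInf {k | EndBy G (fun _ => true) 0 ∅ k}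

/-- The cooling number: only Staller plays. -/
noncomputable def cool {V : Type*} [Fintype V] [DecidableEq V] (G : SimpleGraph V) : ℕ :=
  sInf {k | EndBy G (fun _ => false) 0 ∅ k}

section

variable {V : Type*} {G : SimpleGraph V}

/-- A nonempty vertex set closed under adjacency contains a whole component. -/
lemma three_le_card_of_adj_closed (hc : ∀ c : G.ConnectedComponent, 3 ≤ c.supp.ncard)
    {s : Finset V} (hs : s.Nonempty) (hcl : ∀ u ∈ s, ∀ w, G.Adj u w → w ∈ s) :
    3 ≤ s.card := by
  obtain ⟨x, hx⟩ := hs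
  have hreach : ∀ u w, G.Walk u w → u ∈ s → w ∈ s := by
    intro u w p
    induction p with
    | nil => exact id
    | cons h _ ih => exact fun hu => ih (hcl _ hu _ h)
  have hsub : (G.connectedComponentMk x).supp ⊆ (s : Set V) := by
    intro w hw
    obtain ⟨p⟩ := (SimpleGraph.ConnectedComponent.exact hw).symm
    exact hreach x w p hx
  have hle := Set.ncard_le_ncard hsub s.finite_toSet
  rw [Set.ncard_coe_finset] at hle
  exact (hc _).trans hle

variable [Fintype V] [DecidableEq V]

lemma mem_spread {B : Finset V} {v : V} :
    v ∈ spread G B ↔ v ∈ B ∨ ∃ u ∈ B, G.Adj u v := by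
  simp [spread]

lemma subset_spread (B : Finset V) : B ⊆ spread G B :=
  fun _ hv => mem_spread.2 (Or.inl hv)

/-- If the fire cannot spread, some choice makes it gain two vertices in the next spread. -/
lemma exists_card_add_three_le_of_spread_eq
    (hc : ∀ c : G.ConnectedComponent, 3 ≤ c.supp.ncard)
    {B : Finset V} (hB : spread G B = B) (hne : B ≠ Finset.univ) :
    ∃ v ∉ B, B.card + 3 ≤ (spread G (insert v B)).card := by
  have hout : ∀ u w, G.Adj u w → u ∉ B → w ∉ B := by
    intro u w h hu hw
    exact hu (hB ▸ mem_spread.2 (Or.inr ⟨w, hw, h.symm⟩))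
  have two_neighbors : ∀ v p q, v ∉ B → G.Adj v p → G.Adj v q → p ≠ q →
      B.card + 3 ≤ (spread G (insert v B)).card := by
    intro v p q hv hp hq hpq
    have hsub : insert p (insert q (insert v B)) ⊆ spread G (insert v B) := by
      intro a ha
      simp only [Finset.mem_insert] at ha
      rw [mem_spread]
      rcases ha with rfl | rfl | ha
      · exact Or.inr ⟨v, by simp, hp⟩
      · exact Or.inr ⟨v, by simp, hq⟩
      · exact Or.inl (by simpa using ha)
    have hcard := Finset.card_le_card hsub
    rw [Finset.card_insert_of_notMem (by simp [hpq, hp.ne', hout _ _ hp hv]),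
      Finset.card_insert_of_notMem (by simp [hq.ne', hout _ _ hq hv]),
      Finset.card_insert_of_notMem hv] at hcard
    exact hcard
  obtain ⟨x, hx⟩ : ∃ x, x ∉ B := by
    by_contra! h
    exact hne (Finset.eq_univ_iff_forall.2 h)
  obtain ⟨y, hxy⟩ : ∃ y, G.Adj x y := by
    by_contra! h
    have := three_le_card_of_adj_closed hc (Finset.singleton_nonempty x)
      (fun u hu w huw => absurd huw (Finset.mem_singleton.1 hu ▸ h w))
    simp at this
  obtain ⟨u, hu, z, huz, hz⟩ : ∃ u ∈ ({x, y} : Finset V), ∃ z, G.Adj u z ∧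
      z ∉ ({x, y} : Finset V) := by
    by_contra! h
    have := three_le_card_of_adj_closed hc (Finset.insert_nonempty x {y}) h
    have := Finset.card_le_two (a := x) (b := y)
    omega
  simp only [Finset.mem_insert, Finset.mem_singleton, not_or] at hu hz
  rcases hu with rfl | rfl
  · exact ⟨u, hx, two_neighbors u y z hx hxy huz (Ne.symm hz.2)⟩
  · exact ⟨u, hout _ _ hxy hx, two_neighbors u x z (hout _ _ hxy hx) hxy.symm huz (Ne.symm hz.1)⟩

/-- From any non-full burned set, some choice either ends the game or keeps the fire spreading. -/
lemma exists_insert_eq_univ_or_card_add_two_le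
    (hc : ∀ c : G.ConnectedComponent, 3 ≤ c.supp.ncard)
    {B : Finset V} (hne : B ≠ Finset.univ) :
    ∃ v ∉ B, insert v B = Finset.univ ∨ B.card + 2 ≤ (spread G (insert v B)).card := by
  by_cases hB : spread G B = B
  · obtain ⟨v, hv, h⟩ := exists_card_add_three_le_of_spread_eq hc hB hne
    exact ⟨v, hv, Or.inr (by omega)⟩
  obtain ⟨w, hw, hwB⟩ : ∃ w ∈ spread G B, w ∉ B := by
    by_contra! h
    exact hB (Finset.Subset.antisymm h (subset_spread B))
  obtain ⟨u, huB, huw⟩ := (mem_spread.1 hw).resolve_left hwB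
  by_cases hfull : insert w B = Finset.univ
  · exact ⟨w, hwB, Or.inl hfull⟩
  obtain ⟨v, hv⟩ : ∃ v, v ∉ insert w B := by
    by_contra! h
    exact hfull (Finset.eq_univ_iff_forall.2 h)
  simp only [Finset.mem_insert, not_or] at hv
  refine ⟨v, hv.2, Or.inr ?_⟩
  have hsub : insert w (insert v B) ⊆ spread G (insert v B) :=
    Finset.insert_subset (mem_spread.2 (Or.inr ⟨u, by simp [huB], huw⟩)) (subset_spread _)
  have hcard := Finset.card_le_card hsub
  rwa [Finset.card_insert_of_notMem (by simp [hwB, Ne.symm hv.1]),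
    Finset.card_insert_of_notMem hv.2] at hcard

lemma endBy_univ (turn : ℕ → Bool) (i k : ℕ) : EndBy G turn i Finset.univ k := by
  cases k <;> simp [EndBy]

/-- With alternating turns, Burner wins within `k` rounds if it is his turn and at most `2 * k`
vertices are unburned, or if it is Staller's turn and at most `2 * k - 1` vertices are unburned
after the next spread. -/
lemma endBy_of_card_le (hc : ∀ c : G.ConnectedComponent, 3 ≤ c.supp.ncard)
    {turn : ℕ → Bool} (hturn : ∀ i, turn (i + 1) = !turn i) (k : ℕ) :
    ∀ i B, (turn i = true → Fintype.card V ≤ B.card + 2 * k → EndBy G turn i B k) ∧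
      (turn i = false → Fintype.card V + 1 ≤ (spread G B).card + 2 * k →
        EndBy G turn i B k) := by
  induction k with
  | zero =>
    refine fun i B => ⟨fun _ h => ?_, fun _ h => ?_⟩
    · exact Finset.card_eq_iff_eq_univ B |>.1 (le_antisymm (Finset.card_le_univ B) h)
    · have := Finset.card_le_univ (spread G B)
      omega
  | succ k ih =>
    refine fun i B => ⟨fun hi h => ?_, fun hi h => ?_⟩
    · by_cases hS : spread G B = Finset.univ
      · exact Or.inr (Or.inl hS)
      refine Or.inr (Or.inr ?_)
      rw [if_pos hi]
      have hi' : turn (i + 1) = false := by simp [hturn, hi]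
      by_cases hB : spread G B = B
      · rw [hB] at hS ⊢
        obtain ⟨v, hv, hcard⟩ := exists_card_add_three_le_of_spread_eq hc hB hS
        exact ⟨v, hv, (ih _ _).2 hi' (by omega)⟩
      · have hlt : B.card < (spread G B).card :=
          Finset.card_lt_card ((subset_spread B).ssubset_of_ne (Ne.symm hB))
        obtain ⟨v, hv, hfull | hcard⟩ := exists_insert_eq_univ_or_card_add_two_le hc hS
        · exact ⟨v, hv, hfull ▸ endBy_univ turn _ _⟩
        · exact ⟨v, hv, (ih _ _).2 hi' (by omega)⟩
    · refine Or.inr (Or.inr ?_)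
      rw [if_neg (by simp [hi])]
      intro v hv
      refine (ih _ _).1 (by simp [hturn, hi]) ?_
      rw [Finset.card_insert_of_notMem hv]
      omega

end

theorem stmt11 {V : Type*} [Fintype V] [DecidableEq V] (G : SimpleGraph V)
    (hG : ¬ G.Connected) (hc : ∀ c : G.ConnectedComponent, 3 ≤ c.supp.ncard) :
    (bg G : ℝ) ≤ (Fintype.card V + 1) / 2 ∧ (bg' G : ℝ) ≤ Fintype.card V / 2 + 1 := by
  have hbg : bg G ≤ (Fintype.card V + 1) / 2 :=
    Nat.sInf_le ((endBy_of_card_le hc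
      (fun i => by rcases Nat.mod_two_eq_zero_or_one i with h | h <;> simp [Nat.add_mod, h])
      _ 0 ∅).1 rfl (by omega))
  have hbg' : bg' G ≤ Fintype.card V / 2 + 1 :=
    Nat.sInf_le ((endBy_of_card_le hc
      (fun i => by rcases Nat.mod_two_eq_zero_or_one i with h | h <;> simp [Nat.add_mod, h])
      _ 0 ∅).2 rfl (by omega))
  constructor
  · have h : 2 * bg G ≤ Fintype.card V + 1 := by omega
    have h' : (2 * bg G : ℝ) ≤ Fintype.card V + 1 := by exact_mod_cast h
    linarith
  · have h : 2 * bg' G ≤ Fintype.card V + 2 := by omega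
    have h' : (2 * bg' G : ℝ) ≤ Fintype.card V + 2 := by exact_mod_cast h
    linarith

end BurningGame
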